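/- Consider M jointly realizable linear regression tasks with data radius R > 0, and let w⋆ satisfy X_m w⋆ = y_m for all m. Let k ≥ 2, and suppose the step sizes γ_t ∈ (0, 1/R²) and integer budgets N_t ≥ 1 satisfy the decreasing-budget schedule γ_t·N_t = (3/(13R²))·(k−t+2)/(k+1) for t = 1,…,k. Let τ be a random with-replacement ordering of length k, and let w_0, w_1, …, w_k be the budgeted continual linear regression iterates started from an arbitrary w_0 ∈ ℝ^d. Then the expected average loss satisfies E_τ L(w_k) ≤ 20·‖w_0 − w⋆‖²·R²/(k+1). -/

import Mathlib

open Matrix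

/-- Matrix-vector multiplication viewed as a map between Euclidean spaces. -/
noncomputable def mulVecE {n d : ℕ} (X : Matrix (Fin n) (Fin d) ℝ)
    (v : EuclideanSpace ℝ (Fin d)) : EuclideanSpace ℝ (Fin n) :=
  (WithLp.equiv 2 (Fin n → ℝ)).symm (X.mulVec (WithLp.equiv 2 (Fin d → ℝ) v))

section helpers

variable {E F : Type*} [NormedAddCommGroup E] [InnerProductSpace ℝ E]
  [NormedAddCommGroup F] [InnerProductSpace ℝ F]

lemma aux_adj_bound (X : E →ₗ[ℝ] F) (Y : F →ₗ[ℝ] E) (R : ℝ) (hR : 0 < R)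
    (hadj : ∀ u v, inner ℝ (Y u) v = inner ℝ u (X v)) (hX : ∀ v, ‖X v‖ ≤ R * ‖v‖) (u : F) :
    ‖Y u‖ ≤ R * ‖u‖ := by
  have h1 : ‖Y u‖ ^ 2 ≤ ‖u‖ * (R * ‖Y u‖) := by
    rw [← real_inner_self_eq_norm_sq, hadj]
    exact (real_inner_le_norm _ _).trans (mul_le_mul_of_nonneg_left (hX _) (norm_nonneg _))
  by_contra h
  push Not at h
  have h0 : 0 < ‖Y u‖ := lt_of_le_of_lt (by positivity) h
  nlinarith

/-- One gradient step: change of the residual, and of the distance to `y / u`. -/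
lemma aux_step (X : E →ₗ[ℝ] F) (Y : F →ₗ[ℝ] E) (R : ℝ) (hR : 0 < R)
    (hadj : ∀ u v, inner ℝ (Y u) v = inner ℝ u (X v)) (hX : ∀ v, ‖X v‖ ≤ R * ‖v‖)
    (γ : ℝ) (hγ : 0 < γ) (hγR : γ * R ^ 2 ≤ 1) (v : E) :
    ‖X (v - γ • Y (X v))‖ ^ 2 ≤ ‖X v‖ ^ 2 ∧
    (1 - 2 * γ * R ^ 2) * ‖X v‖ ^ 2 ≤ ‖X (v - γ • Y (X v))‖ ^ 2 ∧
    ∀ (u : ℝ) (z : E), ‖u • (v - γ • Y (X v)) - z‖ ^ 2 ≤ ‖u • v - z‖ ^ 2 + γ * ‖X z‖ ^ 2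
      - γ * (1 - γ * R ^ 2) * u ^ 2 * ‖X v‖ ^ 2 := by
  have hY := aux_adj_bound X Y R hR hadj hX (X v)
  have hXY := hX (Y (X v))
  have e1 : ‖X (v - γ • Y (X v))‖ ^ 2
      = ‖X v‖ ^ 2 - 2 * γ * ‖Y (X v)‖ ^ 2 + γ ^ 2 * ‖X (Y (X v))‖ ^ 2 := by
    rw [map_sub, map_smul, norm_sub_sq_real, norm_smul, inner_smul_right, ← hadj,
      real_inner_self_eq_norm_sq, mul_pow, Real.norm_eq_abs, sq_abs]
    ring
  have hY2 : ‖Y (X v)‖ ^ 2 ≤ R ^ 2 * ‖X v‖ ^ 2 := by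
    rw [← mul_pow]; gcongr
  have hXY2 : ‖X (Y (X v))‖ ^ 2 ≤ R ^ 2 * ‖Y (X v)‖ ^ 2 := by
    rw [← mul_pow]; gcongr
  refine ⟨?_, ?_, ?_⟩
  · rw [e1]
    have h1 : γ ^ 2 * ‖X (Y (X v))‖ ^ 2 ≤ γ ^ 2 * (R ^ 2 * ‖Y (X v)‖ ^ 2) := by gcongr
    have h2 : γ * (γ * R ^ 2) * ‖Y (X v)‖ ^ 2 ≤ γ * 1 * ‖Y (X v)‖ ^ 2 := by gcongr
    have h3 : 0 ≤ γ * ‖Y (X v)‖ ^ 2 := by positivity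
    nlinarith
  · rw [e1]
    have h1 : 0 ≤ γ ^ 2 * ‖X (Y (X v))‖ ^ 2 := by positivity
    have h2 : γ * ‖Y (X v)‖ ^ 2 ≤ γ * (R ^ 2 * ‖X v‖ ^ 2) := by gcongr
    nlinarith
  · intro u z
    have e2 : u • (v - γ • Y (X v)) - z = (u • v - z) - (u * γ) • Y (X v) := by
      rw [smul_sub, smul_smul]; abel
    have e3 : inner ℝ (u • v - z) (Y (X v)) = u * ‖X v‖ ^ 2 - inner ℝ (X v) (X z) := by
      rw [real_inner_comm, hadj, map_sub, map_smul, inner_sub_right, inner_smul_right,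
        real_inner_self_eq_norm_sq]
    rw [e2, norm_sub_sq_real (u • v - z), inner_smul_right, e3, norm_smul, mul_pow,
      Real.norm_eq_abs, sq_abs]
    have h4 : 0 ≤ ‖u • X v - X z‖ ^ 2 := by positivity
    rw [norm_sub_sq_real, inner_smul_left, norm_smul, mul_pow,
      Real.norm_eq_abs, sq_abs] at h4
    simp only [conj_trivial] at h4
    have h5 : (u * γ) ^ 2 * ‖Y (X v)‖ ^ 2 ≤ (u * γ) ^ 2 * (R ^ 2 * ‖X v‖ ^ 2) := by gcongr
    nlinarith [mul_nonneg hγ.le h4]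

lemma aux_iter (X : E →ₗ[ℝ] F) (Y : F →ₗ[ℝ] E) (R : ℝ) (hR : 0 < R)
    (hadj : ∀ u v, inner ℝ (Y u) v = inner ℝ u (X v)) (hX : ∀ v, ‖X v‖ ≤ R * ‖v‖)
    (γ : ℝ) (hγ : 0 < γ) (hγR : γ * R ^ 2 ≤ 1) (v : E) (u : ℝ) (z : E) (N : ℕ) :
    ‖X ((fun v => v - γ • Y (X v))^[N] v)‖ ^ 2 ≤ ‖X v‖ ^ 2 ∧
    (1 - 2 * γ * R ^ 2 * N) * ‖X v‖ ^ 2 ≤ ‖X ((fun v => v - γ • Y (X v))^[N] v)‖ ^ 2 ∧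
    ‖u • ((fun v => v - γ • Y (X v))^[N] v) - z‖ ^ 2 ≤ ‖u • v - z‖ ^ 2 + γ * N * ‖X z‖ ^ 2
      - γ * N * (1 - γ * N * R ^ 2) * u ^ 2 * ‖X v‖ ^ 2 := by
  induction N with
  | zero => simp
  | succ N ih =>
    obtain ⟨i1, i2, i3⟩ := ih
    rw [Function.iterate_succ_apply']
    set x := (fun v => v - γ • Y (X v))^[N] v
    obtain ⟨s1, s2, s3⟩ := aux_step X Y R hR hadj hX γ hγ hγR x
    have s3 := s3 u z
    refine ⟨s1.trans i1, ?_, ?_⟩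
    · refine le_trans ?_ s2
      have : γ * R ^ 2 * ‖X x‖ ^ 2 ≤ γ * R ^ 2 * ‖X v‖ ^ 2 := by gcongr
      push_cast
      nlinarith
    · refine s3.trans ?_
      have h1 : γ * (1 - γ * R ^ 2) * u ^ 2 * ((1 - 2 * γ * R ^ 2 * N) * ‖X v‖ ^ 2) ≤
          γ * (1 - γ * R ^ 2) * u ^ 2 * ‖X x‖ ^ 2 := by
        have : 0 ≤ 1 - γ * R ^ 2 := by linarith
        gcongr
      have h2 : 0 ≤ γ * u ^ 2 * ‖X v‖ ^ 2 * (γ * R ^ 2) * (2 * γ * R ^ 2 * N) := by positivity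
      push_cast
      nlinarith

lemma aux_jensen (X : E →ₗ[ℝ] F) (u : ℕ → ℝ) (e : ℕ → E) (t : ℕ) (hu0 : 0 < u 0)
    (hu : ∀ s < t, u s ≤ u (s + 1)) :
    0 < u t ∧ ‖X (∑ s ∈ Finset.range t, (u (s + 1) - u s) • e (s + 1))‖ ^ 2 ≤
      u t * ∑ s ∈ Finset.range t, (u (s + 1) - u s) * ‖X (e (s + 1))‖ ^ 2 := by
  induction t with
  | zero => simpa using hu0
  | succ t ih =>
    obtain ⟨h0, h1⟩ := ih (fun s hs => hu s (by omega))
    have hd := hu t (by omega)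
    refine ⟨by linarith, ?_⟩
    rw [Finset.sum_range_succ, Finset.sum_range_succ, map_add, map_smul]
    set a := X (∑ s ∈ Finset.range t, (u (s + 1) - u s) • e (s + 1))
    set S := ∑ s ∈ Finset.range t, (u (s + 1) - u s) * ‖X (e (s + 1))‖ ^ 2
    set b := X (e (t + 1))
    obtain ⟨δ, hδ⟩ : ∃ δ, δ = u (t + 1) - u t := ⟨_, rfl⟩
    have hu1 : u (t + 1) = u t + δ := by rw [hδ]; ring
    rw [← hδ, hu1]
    have hδ0 : 0 ≤ δ := by linarith
    have h2 : ‖a + δ • b‖ ≤ ‖a‖ + δ * ‖b‖ := by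
      refine (norm_add_le _ _).trans ?_
      rw [norm_smul, Real.norm_eq_abs, abs_of_nonneg hδ0]
    have h3 : 2 * ‖a‖ * ‖b‖ ≤ S + u t * ‖b‖ ^ 2 := by
      have : u t * (2 * ‖a‖ * ‖b‖) ≤ u t * (S + u t * ‖b‖ ^ 2) := by
        nlinarith [sq_nonneg (‖a‖ - u t * ‖b‖)]
      exact le_of_mul_le_mul_left this h0
    calc ‖a + δ • b‖ ^ 2 ≤ (‖a‖ + δ * ‖b‖) ^ 2 := by gcongr
      _ ≤ _ := by nlinarith [mul_le_mul_of_nonneg_left h3 hδ0]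

end helpers

lemma aux_resample {k M : ℕ} (t : Fin k) (g : (Fin k → Fin M) → Fin M → ℝ)
    (hg : ∀ τ m m', g (Function.update τ t m) m' = g τ m') :
    (M : ℝ) * ∑ τ, g τ (τ t) = ∑ τ, ∑ m, g τ m := by
  have inv : Function.Involutive (fun p : (Fin k → Fin M) × Fin M =>
      (Function.update p.1 t p.2, p.1 t)) := by
    rintro ⟨τ, m⟩
    simp
  have h := Equiv.sum_comp inv.toPerm (fun p : (Fin k → Fin M) × Fin M => g p.1 p.2)
  rw [← Fintype.sum_prod_type' (f := g), ← h]
  simp only [Function.Involutive.coe_toPerm, hg]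
  rw [Fintype.sum_prod_type' (f := fun τ (_ : Fin M) => g τ (τ t))]
  simp [Finset.mul_sum]

/-- The scalar recursion behind the last-iterate bound. -/
lemma aux_scalar (k : ℕ) (u η T D φ p : ℕ → ℝ) (κ C : ℝ)
    (hφ : ∀ t, 0 ≤ φ t)
    (hT : ∀ t ≤ k, T t = η t * u t + T (t + 1)) (hTk : T (k + 1) = 0)
    (hp0 : 0 ≤ p 0) (hp : ∀ t < k, p (t + 1) = (u (t + 1) - u t) * T (t + 1))
    (hcoef : ∀ t < k, p t ≤ η t * (1 - η t * κ) * u t ^ 2)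
    (hD0 : D 0 ≤ C) (hDk : 0 ≤ D (k + 1))
    (hD : ∀ t ≤ k, D (t + 1) ≤ D t + η t * u t * (∑ s ∈ Finset.range t,
      (u (s + 1) - u s) * φ (s + 1)) - η t * (1 - η t * κ) * u t ^ 2 * φ t) :
    (η k * (1 - η k * κ) * u k ^ 2 - p k) * φ k ≤ C := by
  have key : ∀ t ≤ k, D t + (∑ s ∈ Finset.range t,
      (u (s + 1) - u s) * φ (s + 1)) * T t ≤ C + p t * φ t := by
    intro t
    induction t with
    | zero =>
      intro _
      have := mul_nonneg hp0 (hφ 0)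
      simp
      linarith
    | succ t ih =>
      intro ht
      have i := ih (by omega)
      have h1 := hD t (by omega)
      have h2 := mul_le_mul_of_nonneg_right (hcoef t (by omega)) (hφ t)
      rw [hT t (by omega)] at i
      rw [Finset.sum_range_succ, hp t (by omega)]
      nlinarith
  have h := key k le_rfl
  have h1 := hD k le_rfl
  rw [hT k le_rfl, hTk] at h
  nlinarith

lemma mulVecE_adj {n d : ℕ} (X : Matrix (Fin n) (Fin d) ℝ) (u : EuclideanSpace ℝ (Fin n))
    (v : EuclideanSpace ℝ (Fin d)) :
    inner ℝ (mulVecE Xᵀ u) v = inner ℝ u (mulVecE X v) := by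
  simp only [mulVecE, EuclideanSpace.inner_eq_star_dotProduct, WithLp.equiv_apply,
    WithLp.equiv_symm_apply, star_trivial]
  rw [Matrix.mulVec_transpose, dotProduct_comm, ← Matrix.dotProduct_mulVec, dotProduct_comm]

/-- `mulVecE` as a linear map. -/
noncomputable def mulVecELin {n d : ℕ} (X : Matrix (Fin n) (Fin d) ℝ) :
    EuclideanSpace ℝ (Fin d) →ₗ[ℝ] EuclideanSpace ℝ (Fin n) where
  toFun := mulVecE X
  map_add' a b := by
    ext i
    simp [mulVecE, Matrix.mulVec_add]
  map_smul' r a := by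
    ext i
    simp [mulVecE, Matrix.mulVec_smul]

lemma aux_coef (j n c : ℝ) (hj : 1 ≤ j) (hjn : j ≤ n) (hc : 0 ≤ c) (r : ℝ) (hr : c * r = 3 / 13) :
    (1 / j - 1 / (j + 1)) * (c / n * (j + j * (j + 1) / (2 * n))) ≤
      (c * (j / n)) * (1 - (c * (j / n)) * r) * (1 / j + 1 / n) ^ 2 := by
  have hj0 : 0 < j := by linarith
  have hn0 : 0 < n := by linarith
  have e1 : c * (j / n) * r = 3 / 13 * (j / n) := by rw [← hr]; ring
  rw [e1]
  have e2 : (1 / j - 1 / (j + 1)) * (c / n * (j + j * (j + 1) / (2 * n)))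
      = c / n * (1 / (j + 1) + 1 / (2 * n)) := by
    field_simp; ring
  obtain ⟨x, hx⟩ : ∃ x, x = j / n := ⟨_, rfl⟩
  have hx0 : 0 ≤ x := by rw [hx]; positivity
  have hx1 : x ≤ 1 := by rw [hx]; exact (div_le_one hn0).2 hjn
  have e3 : c * (j / n) * (1 - 3 / 13 * (j / n)) * (1 / j + 1 / n) ^ 2
      = c / n * (1 / j * ((1 - 3 / 13 * x) * (1 + x) ^ 2)) := by
    rw [hx]; field_simp
  have e4 : 1 / j + 1 / (2 * n) = 1 / j * (1 + x / 2) := by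
    rw [hx]; field_simp
  rw [e2, e3]
  have h1 : 1 / (j + 1) ≤ 1 / j := one_div_le_one_div_of_le hj0 (by linarith)
  have h2 : 1 + x / 2 ≤ (1 - 3 / 13 * x) * (1 + x) ^ 2 := by
    nlinarith [mul_nonneg hx0 hx0, mul_nonneg hx0 (sub_nonneg.2 hx1),
      mul_nonneg (mul_nonneg hx0 hx0) (sub_nonneg.2 hx1)]
  gcongr
  calc _ ≤ 1 / j + 1 / (2 * n) := by linarith
    _ = _ := e4
    _ ≤ _ := by gcongr

/-- for `M` jointly realizable tasks with data radius `R` and `k ≥ 2`,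
budgeted continual linear regression with step sizes `γ_t ∈ (0, 1/R²)` and budgets
`N_t ≥ 1` satisfying the decreasing schedule `γ_t·N_t = (3/(13R²))(k−t+2)/(k+1)`
(for `t = 1,…,k`; below `t` is 0-indexed, so the step from `w_t` to `w_{t+1}` uses
`γ_{t+1}·N_{t+1} = (3/(13R²))(k−t+1)/(k+1)`) under a random with-replacement ordering
satisfies `E_τ L(w_k) ≤ 20‖w₀−w⋆‖²R²/(k+1)`. -/
theorem optimal_decreasing_budget {d M : ℕ} (hM : 0 < M)
    (nrows : Fin M → ℕ)
    (X : ∀ m : Fin M, Matrix (Fin (nrows m)) (Fin d) ℝ)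
    (y : ∀ m : Fin M, EuclideanSpace ℝ (Fin (nrows m)))
    (R : ℝ) (hR : 0 < R)
    (hX : ∀ (m : Fin M) (v : EuclideanSpace ℝ (Fin d)), ‖mulVecE (X m) v‖ ≤ R * ‖v‖)
    (wstar : EuclideanSpace ℝ (Fin d)) (hreal : ∀ m, mulVecE (X m) wstar = y m)
    (k : ℕ) (hk : 2 ≤ k)
    (γ : Fin k → ℝ) (N : Fin k → ℕ)
    (hγpos : ∀ t, 0 < γ t) (hγR : ∀ t, γ t < 1 / R ^ 2) (hN : ∀ t, 1 ≤ N t)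
    (hsched : ∀ t : Fin k,
      γ t * (N t : ℝ) = (3 / (13 * R ^ 2)) * (((k : ℝ) - (t.1 : ℝ) + 1) / ((k : ℝ) + 1)))
    (w0 : EuclideanSpace ℝ (Fin d))
    (w : (Fin k → Fin M) → ℕ → EuclideanSpace ℝ (Fin d))
    (hw0 : ∀ τ, w τ 0 = w0)
    (hwt : ∀ (τ : Fin k → Fin M) (t : Fin k),
      w τ (t.1 + 1) =
        (fun v : EuclideanSpace ℝ (Fin d) =>
          v - γ t • mulVecE (X (τ t))ᵀ (mulVecE (X (τ t)) v - y (τ t)))^[N t] (w τ t.1)) :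
    (∑ τ : Fin k → Fin M, (1 / (M : ℝ)) * ∑ m, (1 / 2) * ‖mulVecE (X m) (w τ k) - y m‖ ^ 2)
        / (M : ℝ) ^ k
      ≤ 20 * ‖w0 - wstar‖ ^ 2 * R ^ 2 / ((k : ℝ) + 1) := by
  classical
  have hMr : (0 : ℝ) < M := by exact_mod_cast hM
  -- linear maps
  let A : ∀ m, EuclideanSpace ℝ (Fin d) →ₗ[ℝ] EuclideanSpace ℝ (Fin (nrows m)) :=
    fun m => mulVecELin (X m)
  let B : ∀ m, EuclideanSpace ℝ (Fin (nrows m)) →ₗ[ℝ] EuclideanSpace ℝ (Fin d) :=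
    fun m => mulVecELin (X m)ᵀ
  have hAB : ∀ m u v, inner ℝ (B m u) v = inner ℝ u (A m v) := fun m u v => mulVecE_adj (X m) u v
  have hA : ∀ m v, ‖A m v‖ ≤ R * ‖v‖ := hX
  -- errors
  let e : (Fin k → Fin M) → ℕ → EuclideanSpace ℝ (Fin d) := fun τ t => w τ t - wstar
  have he0 : ∀ τ, e τ 0 = w0 - wstar := fun τ => by simp only [e, hw0]
  have hstep : ∀ τ (t : Fin k), e τ (t.1 + 1) =
      (fun v => v - γ t • B (τ t) (A (τ t) v))^[N t] (e τ t.1) := by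
    intro τ t
    simp only [e]
    rw [hwt τ t]
    have hs : Function.Semiconj (fun v : EuclideanSpace ℝ (Fin d) => v - wstar)
        (fun v => v - γ t • mulVecE (X (τ t))ᵀ (mulVecE (X (τ t)) v - y (τ t)))
        (fun v => v - γ t • B (τ t) (A (τ t) v)) := by
      intro v
      have : A (τ t) (v - wstar) = mulVecE (X (τ t)) v - y (τ t) := by
        rw [map_sub, ← hreal]; rfl
      simp only [this]
      change _ - γ t • mulVecE (X (τ t))ᵀ _ - _ = _ - γ t • mulVecE (X (τ t))ᵀ _
      abel
    exact (hs.iterate_right (N t)) (w τ t.1)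
  have hloss : ∀ τ m, ‖mulVecE (X m) (w τ k) - y m‖ = ‖A m (e τ k)‖ := by
    intro τ m
    simp only [e]
    rw [map_sub, ← hreal]; rfl
  -- causality
  have hcausal : ∀ τ (t : Fin k) (m : Fin M), ∀ s ≤ t.1, e (Function.update τ t m) s = e τ s := by
    intro τ t m s
    induction s with
    | zero => intro _; rw [he0, he0]
    | succ s ih =>
      intro hs
      have h1 := hstep (Function.update τ t m) ⟨s, by omega⟩
      have h2 := hstep τ ⟨s, by omega⟩
      simp only at h1 h2
      have hne : (⟨s, by omega⟩ : Fin k) ≠ t := by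
        intro h; rw [← h] at hs; simp at hs
      rw [h1, h2, Function.update_of_ne hne, ih (by omega)]
  -- schedule
  obtain ⟨n, hn⟩ : ∃ n : ℝ, n = (k : ℝ) + 1 := ⟨_, rfl⟩
  have hk' : (2 : ℝ) ≤ k := by exact_mod_cast hk
  have hn3 : 3 ≤ n := by linarith
  have hn0 : 0 < n := by linarith
  let c : ℝ := 3 / (13 * R ^ 2)
  have hc0 : 0 < c := by positivity
  have hcR : c * R ^ 2 = 3 / 13 := by simp only [c]; field_simp
  let u : ℕ → ℝ := fun t => 1 / (n - t) + 1 / n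
  let η : ℕ → ℝ := fun t => c * ((n - t) / n)
  let T : ℕ → ℝ := fun t => c / n * ((n - t) + (n - t) * ((n - t) + 1) / (2 * n))
  let p : ℕ → ℝ := fun t => (1 / (n - t) - 1 / ((n - t) + 1)) * T t
  have hjt : ∀ t : ℕ, t ≤ k → 1 ≤ n - t := by
    intro t ht
    have : (t : ℝ) ≤ k := by exact_mod_cast ht
    linarith
  have hη0 : ∀ t ≤ k, 0 < η t := by
    intro t ht
    have := hjt t ht
    simp only [η]; positivity
  have hη1 : ∀ t ≤ k, η t * R ^ 2 ≤ 1 := by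
    intro t ht
    have : (n - t) / n ≤ 1 := (div_le_one hn0).2 (by linarith [Nat.cast_nonneg (α := ℝ) t])
    have h2 : η t * R ^ 2 = 3 / 13 * ((n - t) / n) := by rw [← hcR]; simp only [η]; ring
    rw [h2]; linarith
  have hηN : ∀ t : Fin k, γ t * N t = η t.1 := by
    intro t
    rw [hsched t]; simp only [η, c, hn]; ring
  have hu0 : 0 < u 0 := by simp only [u]; simp; positivity
  have hdiff : ∀ t < k, u (t + 1) - u t = 1 / (n - (t + 1 : ℕ)) - 1 / ((n - (t + 1 : ℕ)) + 1) := by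
    intro t ht
    simp only [u]
    have : n - (t : ℝ) = n - ((t + 1 : ℕ) : ℝ) + 1 := by push_cast; ring
    rw [this]; ring
  have humono : ∀ t < k, u t ≤ u (t + 1) := by
    intro t ht
    have h1 := hdiff t ht
    have h2 := hjt (t + 1) ht
    have h3 := one_div_le_one_div_of_le (by linarith : 0 < n - (t + 1 : ℕ))
      (by linarith : n - (t + 1 : ℕ) ≤ n - (t + 1 : ℕ) + 1)
    linarith
  -- processes
  let Z : (Fin k → Fin M) → ℕ → EuclideanSpace ℝ (Fin d) := fun τ t =>
    ∑ s ∈ Finset.range t, (u (s + 1) - u s) • e τ (s + 1)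
  let φ : ℕ → ℝ := fun t => ∑ τ : Fin k → Fin M, (1 / (M : ℝ)) * ∑ m, ‖A m (e τ t)‖ ^ 2
  let D0 : ℕ → ℝ := fun t => ∑ τ : Fin k → Fin M, ‖u t • e τ t - Z τ t‖ ^ 2
  let D : ℕ → ℝ := fun t => if t ≤ k then D0 t else 0
  have hφ : ∀ t, 0 ≤ φ t := fun t => by simp only [φ]; positivity
  have hJ : ∀ t ≤ k, ∑ τ : Fin k → Fin M, (1 / (M : ℝ)) * ∑ m, (η t * ‖A m (Z τ t)‖ ^ 2
      - η t * (1 - η t * R ^ 2) * u t ^ 2 * ‖A m (e τ t)‖ ^ 2) ≤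
      η t * u t * (∑ s ∈ Finset.range t, (u (s + 1) - u s) * φ (s + 1))
        - η t * (1 - η t * R ^ 2) * u t ^ 2 * φ t := by
    intro t ht
    have hη := hη0 t ht
    calc _ ≤ ∑ τ : Fin k → Fin M, (1 / (M : ℝ)) * ∑ m, (η t * (u t *
          ∑ s ∈ Finset.range t, (u (s + 1) - u s) * ‖A m (e τ (s + 1))‖ ^ 2)
      - η t * (1 - η t * R ^ 2) * u t ^ 2 * ‖A m (e τ t)‖ ^ 2) := by
          gcongr with τ _ m _
          exact (aux_jensen (A m) u (e τ) t hu0 (fun s hs => humono s (by omega))).2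
      _ = _ := by
        simp only [φ, Finset.sum_sub_distrib, mul_sub, Finset.mul_sum]
        congr 1
        · have hcomm : ∀ τ : Fin k → Fin M, ∑ m, ∑ s ∈ Finset.range t,
              1 / (M : ℝ) * (η t * (u t * ((u (s + 1) - u s) * ‖A m (e τ (s + 1))‖ ^ 2)))
              = ∑ s ∈ Finset.range t, ∑ m,
              1 / (M : ℝ) * (η t * (u t * ((u (s + 1) - u s) * ‖A m (e τ (s + 1))‖ ^ 2))) :=
            fun τ => Finset.sum_comm
          simp only [hcomm]
          rw [Finset.sum_comm]
          refine Finset.sum_congr rfl fun s _ => Finset.sum_congr rfl fun τ _ =>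
            Finset.sum_congr rfl fun m _ => ?_
          ring
        · refine Finset.sum_congr rfl fun τ _ => Finset.sum_congr rfl fun m _ => ?_
          ring
  have hD : ∀ t ≤ k, D (t + 1) ≤ D t + η t * u t * (∑ s ∈ Finset.range t,
      (u (s + 1) - u s) * φ (s + 1)) - η t * (1 - η t * R ^ 2) * u t ^ 2 * φ t := by
    intro t ht
    rw [add_sub_assoc]
    refine le_trans ?_ (add_le_add_right (hJ t ht) (D t))
    have hDt : D t = D0 t := if_pos ht
    rw [hDt]
    rcases lt_or_eq_of_le ht with hlt | heq
    · have hDt1 : D (t + 1) = D0 (t + 1) := if_pos hlt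
      rw [hDt1]
      let g : (Fin k → Fin M) → Fin M → ℝ := fun τ m => η t * ‖A m (Z τ t)‖ ^ 2
        - η t * (1 - η t * R ^ 2) * u t ^ 2 * ‖A m (e τ t)‖ ^ 2
      have hg := aux_resample ⟨t, hlt⟩ g (by
        intro τ m m'
        have hc := hcausal τ ⟨t, hlt⟩ m
        have hZ : Z (Function.update τ ⟨t, hlt⟩ m) t = Z τ t := by
          refine Finset.sum_congr rfl fun s hs => ?_
          rw [hc (s + 1) (by simpa using hs)]
        simp only [g]
        rw [hZ, hc t le_rfl])
      rw [← Finset.mul_sum, ← hg, ← mul_assoc, one_div_mul_cancel hMr.ne', one_mul]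
      simp only [D0]
      rw [← Finset.sum_add_distrib]
      refine Finset.sum_le_sum fun τ _ => ?_
      have h1 : u (t + 1) • e τ (t + 1) - Z τ (t + 1) = u t • e τ (t + 1) - Z τ t := by
        simp only [Z]
        rw [Finset.sum_range_succ, sub_smul]; abel
      have h2 := hstep τ ⟨t, hlt⟩
      simp only at h2
      have hγ1 : γ ⟨t, hlt⟩ * R ^ 2 ≤ 1 := by
        have := hγR ⟨t, hlt⟩
        rw [lt_div_iff₀ (by positivity)] at this
        exact this.le
      have h3 := (aux_iter (A (τ ⟨t, hlt⟩)) (B (τ ⟨t, hlt⟩)) R hR (hAB _) (hA _) (γ ⟨t, hlt⟩)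
        (hγpos _) hγ1 (e τ t) (u t) (Z τ t) (N ⟨t, hlt⟩)).2.2
      rw [← h2, hηN ⟨t, hlt⟩] at h3
      rw [h1]
      simp only [g]
      linarith
    · have hDt1 : D (t + 1) = 0 := if_neg (by omega)
      rw [hDt1]
      simp only [D0]
      rw [← Finset.sum_add_distrib]
      refine Finset.sum_nonneg fun τ _ => ?_
      have h4 : ‖u t • e τ t - Z τ t‖ ^ 2
          = (1 / (M : ℝ)) * ∑ m : Fin M, ‖u t • e τ t - Z τ t‖ ^ 2 := by
        simp [hMr.ne']
      rw [h4, ← mul_add, ← Finset.sum_add_distrib]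
      refine mul_nonneg (by positivity) (Finset.sum_nonneg fun m _ => ?_)
      have h5 := (aux_step (A m) (B m) R hR (hAB m) (hA m) (η t) (hη0 t ht) (hη1 t ht)
        (e τ t)).2.2 (u t) (Z τ t)
      linarith [sq_nonneg ‖u t • (e τ t - η t • B m (A m (e τ t))) - Z τ t‖]
  have main := aux_scalar k u η T D φ p (R ^ 2) ((M : ℝ) ^ k * ((2 / n) ^ 2 * ‖w0 - wstar‖ ^ 2))
    hφ
    (by
      intro t ht
      have := hjt t ht
      have hne : n - (t : ℝ) ≠ 0 := by linarith
      simp only [T, η, u]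
      push_cast
      field_simp
      ring)
    (by simp only [T]; push_cast; rw [hn]; ring)
    (by
      have := hjt 0 (by omega)
      have h3 := one_div_le_one_div_of_le (by linarith : 0 < n - (0 : ℕ))
        (by linarith : n - (0 : ℕ) ≤ n - (0 : ℕ) + 1)
      refine mul_nonneg (by linarith) ?_
      simp only [T]
      positivity)
    (by intro t ht; rw [hdiff t ht])
    (by
      intro t ht
      exact aux_coef (n - t) n c (hjt t ht.le) (by linarith [Nat.cast_nonneg (α := ℝ) t])
        hc0.le (R ^ 2) hcR)
    (by
      have h0 : D 0 = D0 0 := if_pos (by omega)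
      rw [h0]
      have hu : u 0 = 2 / n := by simp only [u]; push_cast; rw [sub_zero]; ring
      simp [D0, Z, he0, hu, norm_smul, mul_pow, abs_of_pos hn0])
    (by
      have h0 : D (k + 1) = 0 := if_neg (by omega)
      rw [h0])
    hD
  have hkj : n - (k : ℝ) = 1 := by rw [hn]; ring
  have hlast : c / n * (1 / 2) ≤ η k * (1 - η k * R ^ 2) * u k ^ 2 - p k := by
    have e1 : η k * R ^ 2 = 3 / 13 * (1 / n) := by
      rw [← hcR]; simp only [η, hkj]; ring
    rw [e1]
    simp only [η, u, p, T, hkj]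
    obtain ⟨x, hx⟩ : ∃ x, x = 1 / n := ⟨_, rfl⟩
    have hx0 : 0 < x := by rw [hx]; positivity
    have hx1 : x ≤ 1 / 3 := by rw [hx]; exact one_div_le_one_div_of_le (by norm_num) hn3
    have e2 : c * (1 / n) * (1 - 3 / 13 * (1 / n)) * (1 / 1 + 1 / n) ^ 2 -
        (1 / 1 - 1 / (1 + 1)) * (c / n * (1 + 1 * (1 + 1) / (2 * n)))
        = c / n * ((1 - 3 / 13 * x) * (1 + x) ^ 2 - 1 / 2 * (1 + x)) := by
      rw [hx]; field_simp; ring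
    rw [e2]
    gcongr
    nlinarith [mul_pos hx0 hx0, mul_nonneg hx0.le (sub_nonneg.2 hx1),
      mul_nonneg (mul_pos hx0 hx0).le (sub_nonneg.2 hx1)]
  have hfin := (mul_le_mul_of_nonneg_right hlast (hφ k)).trans main
  have hgoal : ∑ τ : Fin k → Fin M, (1 / (M : ℝ)) * ∑ m, (1 / 2) * ‖mulVecE (X m) (w τ k) - y m‖ ^ 2
      = φ k / 2 := by
    simp only [hloss, φ, ← Finset.mul_sum]
    ring
  rw [hgoal, ← hn, div_le_iff₀ (by positivity), ← sub_nonneg]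
  have hc' : c = 3 / (13 * R ^ 2) := rfl
  have h6 : φ k ≤ (M : ℝ) ^ k * ‖w0 - wstar‖ ^ 2 * (104 / 3 * R ^ 2 / n) := by
    have hpos : 0 < c / n * (1 / 2) := by positivity
    refine le_of_mul_le_mul_left (hfin.trans (le_of_eq ?_)) hpos
    rw [hc']; field_simp; ring
  have h7 : 0 ≤ (M : ℝ) ^ k * ‖w0 - wstar‖ ^ 2 * (R ^ 2 / n) := by positivity
  have e8 : 20 * ‖w0 - wstar‖ ^ 2 * R ^ 2 / n * (M : ℝ) ^ k
    = 20 * ((M : ℝ) ^ k * ‖w0 - wstar‖ ^ 2 * (R ^ 2 / n)) := by ring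
  have e9 : (M : ℝ) ^ k * ‖w0 - wstar‖ ^ 2 * (104 / 3 * R ^ 2 / n)
    = 104 / 3 * ((M : ℝ) ^ k * ‖w0 - wstar‖ ^ 2 * (R ^ 2 / n)) := by ring
  rw [e8]; rw [e9] at h6
  linarith
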